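/- arXiv:2403.08562 — 3 statements merged into one kernel-verified Lean document; each statement's English description precedes it below -/
import Mathlib

section
/- Let G be a finite simple graph with at least two vertices. Then there exists a graph G' on the same vertex set with G' ≠ G such that for every set S ⊆ V(G) with |S| < κ(G) and all x, y ∈ V(G) ∖ S, the vertices x and y are in the same connected component of G ∖ S if and only if they are in the same connected component of G' ∖ S. (Consequently, no algorithm using only conditional independence tests with conditioning sets of size less than κ(G) can decide whether the underlying graph equals G.) -/
/-- `P` is a family of internally vertex-disjoint paths between `u` and `v` in `G`,
each having at least one internal vertex (i.e. length at least 2). -/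
def InternallyDisjointPaths {V : Type*} (G : SimpleGraph V) {u v : V} {n : ℕ}
    (P : Fin n → G.Path u v) : Prop :=
  (∀ i, 2 ≤ (P i).val.length) ∧
    ∀ i j, i ≠ j →
      List.Disjoint ((P i).val.support.tail.dropLast) ((P j).val.support.tail.dropLast)

/-- `κ(G, u, v)`: the maximum number of internally vertex-disjoint paths between
`u` and `v` in `G`, each having at least one internal vertex. -/
noncomputable def kappa {V : Type*} (G : SimpleGraph V) (u v : V) : ℕ :=
  sSup {n | ∃ P : Fin n → G.Path u v, InternallyDisjointPaths G P}

/-- `κ(G)`: the maximum of `κ(G, u, v)` over all pairs of distinct vertices. -/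
noncomputable def kappaMax {V : Type*} (G : SimpleGraph V) : ℕ :=
  sSup {n | ∃ u v : V, u ≠ v ∧ kappa G u v = n}

/-- `x` and `y` lie in the same connected component of `G ∖ S`, i.e. there is a
walk from `x` to `y` in `G` all of whose vertices avoid `S`. -/
def ConnAvoiding {V : Type*} (G : SimpleGraph V) (S : Set V) (x y : V) : Prop :=
  ∃ p : G.Walk x y, ∀ z ∈ p.support, z ∉ S

theorem Nat.sSup_mem_of_pos {s : Set ℕ} (h : 0 < sSup s) : sSup s ∈ s := by
  by_cases hb : BddAbove s
  · refine Nat.sSup_mem (Set.nonempty_iff_ne_empty.2 ?_) hb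
    rintro rfl
    simp at h
  · simp [Nat.sSup_of_not_bddAbove hb] at h

theorem exists_internallyDisjointPaths_kappaMax {V : Type*} {G : SimpleGraph V}
    (h : 0 < kappaMax G) :
    ∃ u v : V, u ≠ v ∧ ∃ P : Fin (kappaMax G) → G.Path u v, InternallyDisjointPaths G P := by
  obtain ⟨u, v, huv, hk⟩ := Nat.sSup_mem_of_pos h
  refine ⟨u, v, huv, ?_⟩
  change kappa G u v = kappaMax G at hk
  rw [← hk] at h ⊢
  exact Nat.sSup_mem_of_pos h

theorem SimpleGraph.Walk.mem_support_tail_dropLast {V : Type*} {G : SimpleGraph V} {u v z : V}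
    (p : G.Walk u v) (hz : z ∈ p.support) (hu : z ≠ u) (hv : z ≠ v) :
    z ∈ p.support.tail.dropLast := by
  cases p with
  | nil => simp_all
  | cons h q =>
    have hq : z ∈ q.support := by simpa [hu] using hz
    rw [← List.dropLast_append_getLast q.support_ne_nil, List.mem_append, List.mem_singleton,
      q.getLast_support] at hq
    exact hq.resolve_right hv

theorem SimpleGraph.Walk.IsPath.mk_notMem_edges_of_two_le_length {V : Type*} {G : SimpleGraph V}
    {u v : V} {p : G.Walk u v} (hp : p.IsPath) (hl : 2 ≤ p.length) : s(u, v) ∉ p.edges := by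
  cases p with
  | nil => simp at hl
  | cons h q =>
    rw [SimpleGraph.Walk.cons_isPath_iff] at hp
    rw [SimpleGraph.Walk.edges_cons, List.mem_cons, not_or]
    refine ⟨fun he => ?_, fun he => hp.2 (q.fst_mem_support_of_mem_edges he)⟩
    obtain rfl := Sym2.congr_right.1 he
    have := SimpleGraph.Walk.length_eq_zero_iff.2 (SimpleGraph.Walk.isPath_iff_nil.1 hp.1)
    simp [this] at hl

theorem InternallyDisjointPaths.exists_avoiding {V : Type*} {G : SimpleGraph V} {u v : V} {n : ℕ}
    {P : Fin n → G.Path u v} (hP : InternallyDisjointPaths G P) {S : Finset V} (hS : S.card < n)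
    (hu : u ∉ S) (hv : v ∉ S) : ∃ i, ∀ z ∈ (P i).val.support, z ∉ S := by
  by_contra! h
  choose f hf hfS using h
  obtain ⟨i, -, j, -, hij, hfij⟩ := Finset.exists_ne_map_eq_of_card_lt_of_maps_to
    (s := Finset.univ) (t := S) (by simpa using hS) (fun i _ => hfS i)
  have hmem (i) : f i ∈ (P i).val.support.tail.dropLast :=
    (P i).val.mem_support_tail_dropLast (hf i) (fun e => hu (e ▸ hfS i)) (fun e => hv (e ▸ hfS i))
  exact hP.2 i j hij (hmem i) (hfij ▸ hmem j)

theorem ConnAvoiding.trans {V : Type*} {G : SimpleGraph V} {S : Set V} {x y z : V}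
    (h₁ : ConnAvoiding G S x y) (h₂ : ConnAvoiding G S y z) : ConnAvoiding G S x z := by
  obtain ⟨p, hp⟩ := h₁
  obtain ⟨q, hq⟩ := h₂
  refine ⟨p.append q, fun w hw => ?_⟩
  rw [SimpleGraph.Walk.mem_support_append_iff] at hw
  exact hw.elim (hp w) (hq w)

theorem ConnAvoiding.symm {V : Type*} {G : SimpleGraph V} {S : Set V} {x y : V}
    (h : ConnAvoiding G S x y) : ConnAvoiding G S y x := by
  obtain ⟨p, hp⟩ := h
  exact ⟨p.reverse, by simpa using hp⟩

theorem ConnAvoiding.of_adj {V : Type*} {G H : SimpleGraph V} {S : Set V} {x y : V}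
    (hGH : ∀ a b, G.Adj a b → a ∉ S → b ∉ S → ConnAvoiding H S a b)
    (h : ConnAvoiding G S x y) : ConnAvoiding H S x y := by
  obtain ⟨p, hp⟩ := h
  induction p with
  | nil => exact ⟨.nil, by simpa using hp⟩
  | cons h q ih =>
    simp only [SimpleGraph.Walk.support_cons, List.mem_cons, forall_eq_or_imp] at hp
    exact (hGH _ _ h hp.1 (hp.2 _ q.start_mem_support)).trans (ih hp.2)

theorem SimpleGraph.Adj.connAvoiding {V : Type*} {G : SimpleGraph V} {S : Set V} {x y : V}
    (h : G.Adj x y) (hx : x ∉ S) (hy : y ∉ S) : ConnAvoiding G S x y :=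
  ⟨h.toWalk, by simp [hx, hy]⟩

theorem connAvoiding_deleteEdges_iff {V : Type*} {G : SimpleGraph V} {S : Set V} {u v x y : V}
    (huv : u ∉ S → v ∉ S → ConnAvoiding (G.deleteEdges {s(u, v)}) S u v) :
    ConnAvoiding (G.deleteEdges {s(u, v)}) S x y ↔ ConnAvoiding G S x y := by
  refine ⟨.of_adj fun a b hab => (SimpleGraph.deleteEdges_le _ hab).connAvoiding,
    .of_adj fun a b hab ha hb => ?_⟩
  by_cases he : s(a, b) = s(u, v)
  · obtain ⟨rfl, rfl⟩ | ⟨rfl, rfl⟩ := Sym2.eq_iff.1 he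
    · exact huv ha hb
    · exact (huv hb ha).symm
  · exact (SimpleGraph.deleteEdges_adj.2 ⟨hab, he⟩).connAvoiding ha hb

theorem InternallyDisjointPaths.connAvoiding_deleteEdges {V : Type*} {G : SimpleGraph V}
    {u v : V} {n : ℕ} {P : Fin n → G.Path u v} (hP : InternallyDisjointPaths G P)
    {S : Finset V} (hS : S.card < n) (hu : u ∉ S) (hv : v ∉ S) :
    ConnAvoiding (G.deleteEdges {s(u, v)}) S u v := by
  obtain ⟨i, hi⟩ := hP.exists_avoiding hS hu hv
  have he := (P i).property.mk_notMem_edges_of_two_le_length (hP.1 i)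
  exact ⟨(P i).val.toDeleteEdge s(u, v) he, by simpa using hi⟩

/-- For every graph `G` with at least two vertices there is a different graph `G'`
on the same vertex set such that for every `S` with `|S| < κ(G)`, the graphs
`G ∖ S` and `G' ∖ S` have exactly the same connected components. -/
theorem stmt2 {V : Type*} [Fintype V] (G : SimpleGraph V) (hV : 2 ≤ Fintype.card V) :
    ∃ G' : SimpleGraph V, G' ≠ G ∧
      ∀ S : Finset V, S.card < kappaMax G → ∀ x y : V, x ∉ S → y ∉ S →
        (ConnAvoiding G ↑S x y ↔ ConnAvoiding G' ↑S x y) := by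
  obtain h0 | hpos := (kappaMax G).eq_zero_or_pos
  · have : Nontrivial V := Fintype.one_lt_card_iff_nontrivial.1 hV
    exact ⟨Gᶜ, compl_ne_self, fun S hS => by omega⟩
  obtain ⟨u, v, huv, P, hP⟩ := exists_internallyDisjointPaths_kappaMax hpos
  by_cases hadj : G.Adj u v
  · refine ⟨G.deleteEdges {s(u, v)}, fun h => ?_, fun S hS x y _ _ =>
      (connAvoiding_deleteEdges_iff (hP.connAvoiding_deleteEdges hS)).symm⟩
    rw [← h] at hadj
    simp at hadj
  · have hdel : (G ⊔ SimpleGraph.edge u v).deleteEdges {s(u, v)} = G := by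
      ext a b
      simp only [SimpleGraph.deleteEdges_adj, SimpleGraph.sup_adj, SimpleGraph.edge_adj,
        Set.mem_singleton_iff, Sym2.eq_iff]
      grind [SimpleGraph.adj_comm]
    refine ⟨G ⊔ SimpleGraph.edge u v, fun h => hadj ?_, fun S hS x y _ _ => ?_⟩
    · rw [← h]
      simp [SimpleGraph.edge_adj, huv]
    · have hG : G.deleteEdges {s(u, v)} = G := by simpa using hadj
      have hconn := connAvoiding_deleteEdges_iff (G := G ⊔ SimpleGraph.edge u v)
        (S := (S : Set V)) (u := u) (v := v) (x := x) (y := y)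
      rw [hdel] at hconn
      exact hconn fun hu hv => hG ▸ hP.connAvoiding_deleteEdges hS hu hv
end

section
/- Let G and H be finite simple graphs on the same vertex set V, and let k be an integer with κ(G) ≤ k and κ(H) ≤ k. Suppose that for every set S ⊆ V with |S| ≤ k and all distinct u, v ∈ V ∖ S, the vertices u and v are in the same connected component of G ∖ S if and only if they are in the same connected component of H ∖ S. Then G = H. (Hence a graph G is uniquely determined by the answers to all conditional independence tests with conditioning sets of size at most κ(G).) -/
/-- The interior vertices visited, starting from the copy `i` of the source, by iterating `f`
before it first leaves the left summand. -/
inductive Trace {W ι : Type*} (f : W ⊕ ι → W ⊕ ι) (i : ι) : W → Prop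
  | base {w : W} : f (Sum.inr i) = Sum.inl w → Trace f i w
  | step {w w' : W} : Trace f i w → f (Sum.inl w) = Sum.inl w' → Trace f i w'

theorem Trace.eq_of_injective {W ι : Type*} {f : W ⊕ ι → W ⊕ ι} (hf : f.Injective) {i j : ι}
    {w : W} (hi : Trace f i w) (hj : Trace f j w) : i = j := by
  induction hi with
  | base h =>
    cases hj with
    | base h' => exact Sum.inr_injective (hf (h.trans h'.symm))
    | step _ h' => exact absurd (hf (h.trans h'.symm)) Sum.inr_ne_inl
  | step _ h ih =>
    cases hj with
    | base h' => exact absurd (hf (h.trans h'.symm)) Sum.inl_ne_inr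
    | step hw h' =>
      obtain rfl := Sum.inl_injective (hf (h.trans h'.symm))
      exact ih hw

/-- The vertices other than `s` and `t`. -/
abbrev InnerVertex {V : Type*} (s t : V) : Type _ := {v : V // v ≠ s ∧ v ≠ t}

/-- The allowed transitions of a path system from `s` to `t` (whose copies, indexed by `ι`, are
the elements `Sum.inr i`); an inner vertex unused by the system is sent to itself. -/
def LinkStep {V : Type*} (G : SimpleGraph V) (s t : V) (ι : Type*) :
    InnerVertex s t ⊕ ι → InnerVertex s t ⊕ ι → Prop
  | Sum.inl v, Sum.inl w => v = w ∨ G.Adj v w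
  | Sum.inl v, Sum.inr _ => G.Adj v t
  | Sum.inr _, Sum.inl w => G.Adj s w
  | Sum.inr _, Sum.inr _ => False

theorem exists_walk_of_trace {V ι : Type*} {G : SimpleGraph V} {s t : V}
    {f : InnerVertex s t ⊕ ι → InnerVertex s t ⊕ ι} (hstep : ∀ x, LinkStep G s t ι x (f x))
    {i j : ι} (n : ℕ) : ∀ w : InnerVertex s t, Trace f i w → f^[n] (Sum.inl w) = Sum.inr j →
      ∃ p : G.Walk w t, ∀ z ∈ p.support, z = t ∨ ∃ w' : InnerVertex s t, w' = z ∧ Trace f i w' := by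
  induction n with
  | zero => intro w _ h; exact absurd h Sum.inl_ne_inr
  | succ n ih =>
    intro w hw h
    have hs := hstep (Sum.inl w)
    rw [Function.iterate_succ_apply] at h
    rcases hfw : f (Sum.inl w) with w' | l
    · rw [hfw] at h hs
      obtain ⟨p, hp⟩ := ih w' (hw.step hfw) h
      rcases hs with rfl | hadj
      · exact ⟨p, hp⟩
      · refine ⟨SimpleGraph.Walk.cons hadj p, fun z hz ↦ ?_⟩
        rw [SimpleGraph.Walk.support_cons, List.mem_cons] at hz
        rcases hz with rfl | hz
        · exact Or.inr ⟨w, rfl, hw⟩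
        · exact hp z hz
    · rw [hfw] at hs
      have hadj : G.Adj w t := hs
      refine ⟨hadj.toWalk, fun z hz ↦ ?_⟩
      simp only [SimpleGraph.Walk.support_cons, SimpleGraph.Walk.support_nil, List.mem_cons,
        List.not_mem_nil, or_false] at hz
      rcases hz with rfl | rfl
      · exact Or.inr ⟨w, rfl, hw⟩
      · exact Or.inl rfl

theorem SimpleGraph.Walk.IsPath.ne_of_mem_support_tail_dropLast {V : Type*} {G : SimpleGraph V}
    {u v z : V} {p : G.Walk u v} (hp : p.IsPath) (hz : z ∈ p.support.tail.dropLast) :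
    z ∈ p.support ∧ z ≠ u ∧ z ≠ v := by
  have hnd := hp.support_nodup
  cases p with
  | nil => simp at hz
  | cons h q =>
    rw [SimpleGraph.Walk.support_cons, List.tail_cons] at hz
    rw [SimpleGraph.Walk.support_cons, List.nodup_cons] at hnd
    have hzq := List.mem_of_mem_dropLast hz
    refine ⟨List.mem_cons_of_mem _ hzq, fun h ↦ hnd.1 (h ▸ hzq), ?_⟩
    rintro rfl
    have hq := hnd.2
    rw [← List.dropLast_append_getLast q.support_ne_nil, q.getLast_support,
      List.nodup_append] at hq
    exact hq.2.2 _ hz _ (List.mem_singleton_self _) rfl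

theorem exists_internallyDisjointPaths_of_linkStep {V : Type*} [Finite V] {G : SimpleGraph V}
    {s t : V} (hst : s ≠ t) (hadj : ¬ G.Adj s t) {n : ℕ}
    {f : InnerVertex s t ⊕ Fin n → InnerVertex s t ⊕ Fin n} (hf : f.Injective)
    (hstep : ∀ x, LinkStep G s t (Fin n) x (f x)) :
    ∃ P : Fin n → G.Path s t, InternallyDisjointPaths G P := by
  classical
  have hpath : ∀ i, ∃ p : G.Path s t, ∀ z ∈ p.val.support,
      z = s ∨ z = t ∨ ∃ w : InnerVertex s t, w = z ∧ Trace f i w := by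
    intro i
    obtain ⟨m, hm, hfix⟩ := hf.mem_periodicPts (Sum.inr i)
    obtain ⟨m, rfl⟩ := Nat.exists_eq_succ_of_ne_zero hm.ne'
    have hs := hstep (Sum.inr i)
    rcases hfi : f (Sum.inr i) with w | l
    · rw [hfi] at hs
      have hsw : G.Adj s w := hs
      have hret : f^[m] (Sum.inl w) = Sum.inr i := by
        rw [← hfi, ← Function.iterate_succ_apply]; exact hfix
      obtain ⟨p, hp⟩ := exists_walk_of_trace hstep m w (.base hfi) hret
      refine ⟨(SimpleGraph.Walk.cons hsw p).toPath, fun z hz ↦ ?_⟩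
      have hz' := SimpleGraph.Walk.support_toPath_subset_support _ hz
      rw [SimpleGraph.Walk.support_cons, List.mem_cons] at hz'
      exact hz'.imp_right (hp z)
    · rw [hfi] at hs
      exact hs.elim
  choose P hP using hpath
  refine ⟨P, fun i ↦ ?_, fun i j hij z hzi hzj ↦ hij ?_⟩
  · by_contra! hlt
    interval_cases hl : (P i).val.length
    · exact hst (SimpleGraph.Walk.eq_of_length_eq_zero hl)
    · exact hadj (SimpleGraph.Walk.adj_of_length_eq_one hl)
  · obtain ⟨hi, hs, ht⟩ := (P i).property.ne_of_mem_support_tail_dropLast hzi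
    obtain ⟨hj, -, -⟩ := (P j).property.ne_of_mem_support_tail_dropLast hzj
    obtain ⟨w, hw, hwi⟩ := ((hP i z hi).resolve_left hs).resolve_left ht
    obtain ⟨w', hw', hwj⟩ := ((hP j z hj).resolve_left hs).resolve_left ht
    obtain rfl := Subtype.ext (hw.trans hw'.symm)
    exact hwi.eq_of_injective hf hwj

theorem not_connAvoiding_of_closed {V : Type*} {G : SimpleGraph V} {S C : Set V} {s t : V}
    (hs : s ∈ C) (ht : t ∉ C) (hC : ∀ x ∈ C, ∀ y, G.Adj x y → y ∉ S → y ∈ C) :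
    ¬ ConnAvoiding G S s t := by
  rintro ⟨p, hp⟩
  induction p with
  | nil => exact ht hs
  | cons h q ih =>
    refine ih (hC _ hs _ h (hp _ ?_)) ht fun z hz ↦ hp z ?_
    · simp
    · simp [hz]

open Classical in
/-- Hall's condition for `LinkStep` holds when no set of fewer than `n` vertices separates
`s` from `t`. -/
theorem card_le_card_linkStep {V : Type*} [Fintype V] {G : SimpleGraph V} {s t : V}
    (hst : s ≠ t) (hadj : ¬ G.Adj s t) {n : ℕ}
    (hsep : ∀ S : Finset V, s ∉ S → t ∉ S → ¬ ConnAvoiding G S s t → n ≤ S.card)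
    (X : Finset (InnerVertex s t ⊕ Fin n)) :
    X.card ≤ (Finset.univ.filter fun b ↦ ∃ a ∈ X, LinkStep G s t (Fin n) a b).card := by
  set N := Finset.univ.filter fun b ↦ ∃ a ∈ X, LinkStep G s t (Fin n) a b with hN
  have hleft : X.toLeft ⊆ N.toLeft := by
    intro w hw
    rw [Finset.mem_toLeft] at hw ⊢
    exact Finset.mem_filter.2 ⟨Finset.mem_univ _, _, hw, Or.inl rfl⟩
  have hcard := Finset.card_le_card hleft
  rw [← Finset.card_toLeft_add_card_toRight (u := X),
    ← Finset.card_toLeft_add_card_toRight (u := N)]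
  have hXr : X.toRight.card ≤ n := by simpa using Finset.card_le_univ X.toRight
  rcases X.toRight.eq_empty_or_nonempty with hr | ⟨i, hi⟩
  · rw [hr, Finset.card_empty]; omega
  rw [Finset.mem_toRight] at hi
  by_cases ht : ∃ w ∈ X.toLeft, G.Adj w.1 t
  · obtain ⟨w, hw, hwt⟩ := ht
    have hNr : N.toRight = Finset.univ := by
      refine Finset.eq_univ_of_forall fun j ↦ ?_
      rw [Finset.mem_toRight]
      exact Finset.mem_filter.2 ⟨Finset.mem_univ _, _, Finset.mem_toLeft.1 hw, hwt⟩
    rw [hNr, Finset.card_univ, Fintype.card_fin]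
    omega
  push Not at ht
  set S : Finset V := (N.toLeft \ X.toLeft).map (Function.Embedding.subtype _) with hS
  have hmem : ∀ (w : InnerVertex s t), w ∈ N.toLeft → w.1 ∉ S → w ∈ X.toLeft := by
    intro w hw hwS
    by_contra hwX
    exact hwS (Finset.mem_map_of_mem _ (Finset.mem_sdiff.2 ⟨hw, hwX⟩))
  have hS' : n ≤ S.card := by
    refine hsep S (by simp [hS]) (by simp [hS]) ?_
    refine not_connAvoiding_of_closed
      (C := {x | x = s ∨ ∃ w ∈ X.toLeft, w.1 = x}) (Or.inl rfl) ?_ ?_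
    · rintro (h | ⟨w, -, h⟩)
      · exact hst h.symm
      · exact w.2.2 h
    · rintro x hx y hxy hyS
      by_cases hys : y = s
      · exact Or.inl hys
      have hyt : y ≠ t := by
        rintro rfl
        rcases hx with rfl | ⟨w, hw, rfl⟩
        · exact hadj hxy
        · exact ht w hw hxy
      refine Or.inr ⟨⟨y, hys, hyt⟩, hmem _ ?_ hyS, rfl⟩
      rw [Finset.mem_toLeft]
      refine Finset.mem_filter.2 ⟨Finset.mem_univ _, ?_⟩
      rcases hx with rfl | ⟨w, hw, rfl⟩
      · exact ⟨_, hi, hxy⟩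
      · exact ⟨_, Finset.mem_toLeft.1 hw, Or.inr hxy⟩
  rw [hS, Finset.card_map, Finset.card_sdiff_of_subset hleft] at hS'
  omega

theorem InternallyDisjointPaths.card_le {V : Type*} [Fintype V] {G : SimpleGraph V} {u v : V}
    {n : ℕ} {P : Fin n → G.Path u v} (hP : InternallyDisjointPaths G P) :
    n ≤ Fintype.card V := by
  have hne : ∀ i, ∃ z, z ∈ (P i).val.support.tail.dropLast := fun i ↦ by
    have hlen := hP.1 i
    refine List.exists_mem_of_length_pos ?_
    rw [List.length_dropLast, List.length_tail, SimpleGraph.Walk.length_support]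
    omega
  choose z hz using hne
  have hinj : z.Injective := fun i j hij ↦ by
    by_contra h
    exact hP.2 i j h (hz i) (hij ▸ hz j)
  simpa using Fintype.card_le_of_injective z hinj

theorem InternallyDisjointPaths.le_kappa {V : Type*} [Fintype V] {G : SimpleGraph V} {u v : V}
    {n : ℕ} {P : Fin n → G.Path u v} (hP : InternallyDisjointPaths G P) : n ≤ kappa G u v :=
  le_csSup ⟨Fintype.card V, fun _ ⟨_, hQ⟩ ↦ hQ.card_le⟩ ⟨P, hP⟩

theorem kappa_le_kappaMax {V : Type*} [Finite V] (G : SimpleGraph V) {u v : V} (h : u ≠ v) :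
    kappa G u v ≤ kappaMax G := by
  refine le_csSup (Set.Finite.bddAbove ?_) ⟨u, v, h, rfl⟩
  refine (Set.finite_range fun x : V × V ↦ kappa G x.1 x.2).subset ?_
  rintro _ ⟨a, b, -, rfl⟩
  exact ⟨(a, b), rfl⟩

/-- **Menger's theorem** for a pair of nonadjacent vertices. -/
theorem exists_separator_card_le_kappa {V : Type*} [Fintype V] {G : SimpleGraph V} {s t : V}
    (hst : s ≠ t) (hadj : ¬ G.Adj s t) :
    ∃ S : Finset V, S.card ≤ kappa G s t ∧ s ∉ S ∧ t ∉ S ∧ ¬ ConnAvoiding G S s t := by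
  classical
  by_contra! hcon
  obtain ⟨f, hf, hstep⟩ :=
    (Fintype.all_card_le_filter_rel_iff_exists_injective
      (LinkStep G s t (Fin (kappa G s t + 1)))).1 (card_le_card_linkStep hst hadj
        fun S hs ht hS ↦ by
          by_contra! hlt
          exact hS (hcon S (Nat.lt_succ_iff.1 hlt) hs ht))
  obtain ⟨P, hP⟩ := exists_internallyDisjointPaths_of_linkStep hst hadj hf hstep
  exact absurd hP.le_kappa (Nat.not_succ_le_self _)

theorem le_of_connAvoiding_imp {V : Type*} [Fintype V] {G H : SimpleGraph V} {k : ℤ}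
    (hH : (kappaMax H : ℤ) ≤ k)
    (htests : ∀ S : Finset V, (S.card : ℤ) ≤ k → ∀ u v : V, u ≠ v → u ∉ S → v ∉ S →
      ConnAvoiding G ↑S u v → ConnAvoiding H ↑S u v) :
    G ≤ H := by
  intro u v huv
  by_contra hadj
  obtain ⟨S, hcard, hu, hv, hS⟩ := exists_separator_card_le_kappa huv.ne hadj
  have hk := kappa_le_kappaMax H huv.ne
  refine hS (htests S (by omega) u v huv.ne hu hv ⟨huv.toWalk, fun z hz ↦ ?_⟩)
  simp only [SimpleGraph.Walk.support_cons, SimpleGraph.Walk.support_nil, List.mem_cons,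
    List.not_mem_nil, or_false] at hz
  rcases hz with rfl | rfl
  · exact hu
  · exact hv

/-- If `κ(G) ≤ k`, `κ(H) ≤ k`, and all conditional independence tests with
conditioning sets of size at most `k` give the same answers on `G` and `H`,
then `G = H`. -/
theorem stmt4 {V : Type*} [Fintype V] (G H : SimpleGraph V) (k : ℤ)
    (hG : (kappaMax G : ℤ) ≤ k) (hH : (kappaMax H : ℤ) ≤ k)
    (htests : ∀ S : Finset V, (S.card : ℤ) ≤ k → ∀ u v : V, u ≠ v → u ∉ S → v ∉ S →
      (ConnAvoiding G ↑S u v ↔ ConnAvoiding H ↑S u v)) :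
    G = H := by
  exact le_antisymm
    (le_of_connAvoiding_imp hH fun S hS u v huv hu hv ↦ (htests S hS u v huv hu hv).1)
    (le_of_connAvoiding_imp hG fun S hS u v huv hu hv ↦ (htests S hS u v huv hu hv).2)
end

section
/- Let G be a finite simple graph, let u, v be distinct vertices of G, and let k be an integer such that κ(G, u, v) > k. Then every tree decomposition of G of width at most k contains a bag that contains both u and v. -/
/-- `(T, bag)` is a tree decomposition of `G`: `T` is a tree, every vertex of
`G` is in some bag, every edge of `G` is contained in some bag, and for every
vertex of `G` the nodes of `T` whose bags contain it induce a connected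
subtree of `T`. -/
def IsTreeDecomposition {V ι : Type*} (G : SimpleGraph V) (T : SimpleGraph ι)
    (bag : ι → Set V) : Prop :=
  T.IsTree ∧
  (∀ v : V, ∃ t, v ∈ bag t) ∧
  (∀ u v : V, G.Adj u v → ∃ t, u ∈ bag t ∧ v ∈ bag t) ∧
  (∀ v : V, ∀ t₁ t₂ : ι, v ∈ bag t₁ → v ∈ bag t₂ →
    ∃ p : T.Walk t₁ t₂, ∀ t ∈ p.support, v ∈ bag t)

namespace SimpleGraph

/-- A walk ending outside `S` either avoids `S`, or leaves `S` for the last time along an edge. -/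
theorem Walk.avoids_or_exists_last_exit {ι : Type*} {T : SimpleGraph ι} (S : Set ι) {a b : ι}
    (p : T.Walk a b) (hb : b ∉ S) :
    (∀ x ∈ p.support, x ∉ S) ∨
      ∃ s t, T.Adj s t ∧ s ∈ S ∧ ∃ q : T.Walk t b, ∀ x ∈ q.support, x ∉ S := by
  induction p with
  | nil => left; simpa using hb
  | @cons a c b h p ih =>
    rcases ih hb with hp | hp
    · by_cases ha : a ∈ S
      · exact Or.inr ⟨a, c, h, ha, p, hp⟩
      · left
        simpa [ha] using hp
    · exact Or.inr hp

/-- A vertex of a walk distinct from both ends is an internal vertex. -/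
theorem Walk.mem_tail_dropLast_support {V : Type*} {G : SimpleGraph V} {u v w : V}
    (p : G.Walk u v) (hw : w ∈ p.support) (hu : w ≠ u) (hv : w ≠ v) :
    w ∈ p.support.tail.dropLast := by
  cases p with
  | nil => simp_all
  | cons h p =>
    simp only [Walk.support_cons, List.mem_cons, hu, false_or, List.tail_cons] at hw ⊢
    rw [← List.dropLast_concat_getLast p.support_ne_nil, List.mem_append, List.mem_singleton,
      p.getLast_support] at hw
    exact hw.resolve_right hv

/-- A walk that does not contain both ends of an edge survives the deletion of that edge. -/
theorem Walk.reachable_deleteEdge {ι : Type*} {T : SimpleGraph ι} {s t x y : ι}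
    (p : T.Walk x y) (hp : s ∉ p.support ∨ t ∉ p.support) :
    (T.deleteEdges {s(s, t)}).Reachable x y := by
  refine ⟨p.toDeleteEdge s(s, t) fun he => ?_⟩
  rcases hp with h | h
  · exact h (p.fst_mem_support_of_mem_edges he)
  · exact h (p.snd_mem_support_of_mem_edges he)

end SimpleGraph

/-- The intersection of the bags at the ends of a tree edge separates vertices whose bags lie
on different sides of that edge. -/
theorem IsTreeDecomposition.exists_mem_support_inter {V ι : Type*} {G : SimpleGraph V}
    {T : SimpleGraph ι} {bag : ι → Set V} (hdecomp : IsTreeDecomposition G T bag) {s t : ι}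
    {u v : V} (p : G.Walk u v) {x y : ι} (hx : u ∈ bag x) (hy : v ∈ bag y)
    (hsx : (T.deleteEdges {s(s, t)}).Reachable s x)
    (hsy : ¬ (T.deleteEdges {s(s, t)}).Reachable s y) :
    ∃ w ∈ p.support, w ∈ bag s ∩ bag t := by
  have same_side : ∀ {w : V} {x y : ι}, w ∉ bag s ∩ bag t → w ∈ bag x → w ∈ bag y →
      (T.deleteEdges {s(s, t)}).Reachable x y := by
    intro w x y hw hx hy
    obtain ⟨q, hq⟩ := hdecomp.2.2.2 w x y hx hy
    refine q.reachable_deleteEdge ?_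
    by_contra! h
    exact hw ⟨hq _ h.1, hq _ h.2⟩
  induction p generalizing x with
  | nil =>
    by_contra! h
    exact hsy (hsx.trans (same_side (h _ (by simp)) hx hy))
  | @cons a c b hac p ih =>
    by_cases ha : a ∈ bag s ∩ bag t
    · exact ⟨a, by simp, ha⟩
    · obtain ⟨z, haz, hcz⟩ := hdecomp.2.2.1 a c hac
      obtain ⟨w, hw, hw'⟩ := ih hcz hy (hsx.trans (same_side ha hx haz))
      exact ⟨w, by simp [hw], hw'⟩

/-- Two vertices with no common bag are separated by an adhesion set containing neither. -/
theorem IsTreeDecomposition.exists_adhesion_separator {V ι : Type*} {G : SimpleGraph V}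
    {T : SimpleGraph ι} {bag : ι → Set V} (hdecomp : IsTreeDecomposition G T bag) {u v : V}
    (h : ∀ t, u ∈ bag t → v ∉ bag t) :
    ∃ s t, u ∈ bag s ∧ u ∉ bag t ∧
      ∀ p : G.Walk u v, ∃ w ∈ p.support, w ∈ bag s ∩ bag t := by
  obtain ⟨x, hx⟩ := hdecomp.2.1 u
  obtain ⟨y, hy⟩ := hdecomp.2.1 v
  obtain ⟨r⟩ := hdecomp.1.connected.preconnected x y
  rcases r.avoids_or_exists_last_exit {z | u ∈ bag z} (fun hu => h y hu hy) with hr | hr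
  · exact absurd hx (hr x r.start_mem_support)
  obtain ⟨s, t, hst, hs, q, hq⟩ := hr
  refine ⟨s, t, hs, hq t q.start_mem_support, fun p =>
    hdecomp.exists_mem_support_inter p hs hy .rfl fun hsy => ?_⟩
  have hty : (T.deleteEdges {s(s, t)}).Reachable t y :=
    q.reachable_deleteEdge (Or.inl fun hmem => hq s hmem hs)
  have hbridge := SimpleGraph.isAcyclic_iff_forall_adj_isBridge.1 hdecomp.1.isAcyclic hst
  exact SimpleGraph.isBridge_iff.1 hbridge (hsy.trans hty.symm)

/-- A positive `κ(G, u, v)` is attained. -/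
theorem exists_internallyDisjointPaths_of_kappa_pos {V : Type*} {G : SimpleGraph V} {u v : V}
    (h : 0 < kappa G u v) :
    ∃ P : Fin (kappa G u v) → G.Path u v, InternallyDisjointPaths G P := by
  refine Nat.sSup_mem (s := {n | ∃ P : Fin n → G.Path u v, InternallyDisjointPaths G P})
    ⟨0, Fin.elim0, fun i => i.elim0, fun i => i.elim0⟩ ?_
  by_contra hb
  exact h.ne' (Nat.sSup_of_not_bddAbove hb)

/-- If `κ(G, u, v) > k`, then every tree decomposition of `G` of width at most
`k` (i.e. in which every bag has at most `k + 1` vertices) contains a bag that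
contains both `u` and `v`. -/
theorem stmt13 {V : Type*} [Fintype V] (G : SimpleGraph V) (u v : V) (huv : u ≠ v)
    (k : ℤ) (hk : k < (kappa G u v : ℤ))
    {ι : Type*} (T : SimpleGraph ι) (bag : ι → Set V)
    (hdecomp : IsTreeDecomposition G T bag)
    (hwidth : ∀ t : ι, ((bag t).ncard : ℤ) ≤ k + 1) :
    ∃ t : ι, u ∈ bag t ∧ v ∈ bag t := by
  by_contra! h
  obtain ⟨s, t, hus, hut, hsep⟩ := hdecomp.exists_adhesion_separator h
  have hcard : (bag s ∩ bag t).ncard < (bag s).ncard :=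
    Set.ncard_lt_ncard ⟨Set.inter_subset_left, fun hsub => hut (hsub hus).2⟩ (Set.toFinite _)
  have hk' := hwidth s
  obtain ⟨P, -, hdisj⟩ := exists_internallyDisjointPaths_of_kappa_pos (G := G) (u := u) (v := v)
    (by omega)
  choose f hf hfmem using fun i => hsep (P i).val
  have hinternal : ∀ i, f i ∈ (P i).val.support.tail.dropLast := fun i =>
    (P i).val.mem_tail_dropLast_support (hf i) (fun he => hut (he ▸ (hfmem i).2))
      (fun he => h s hus (he ▸ (hfmem i).1))
  have hinj : Function.Injective f := by
    intro i j hij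
    by_contra hne
    exact hdisj i j hne (hinternal i) (hij ▸ hinternal j)
  have hle : kappa G u v ≤ (bag s ∩ bag t).ncard := by
    calc kappa G u v = (Set.range f).ncard := by
          rw [← Set.image_univ, Set.ncard_image_of_injective _ hinj, Set.ncard_univ, Nat.card_fin]
      _ ≤ _ := Set.ncard_le_ncard (Set.range_subset_iff.2 hfmem) (Set.toFinite _)
  omega
end
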